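/- Let s ∈ ℝ^n and τ > 0. Define the relaxed sort matrix P̂_{sort(s)}(τ) whose i-th row is softmax(((n + 1 − 2i)·s − A_s·𝟙)/τ), where A_s[i,j] = |s_i − s_j| and 𝟙 is the all-ones vector. Then P̂_{sort(s)}(τ) is a row-stochastic matrix: all entries are strictly positive and every row sums to 1. Moreover, if the entries of s are pairwise distinct and u ∈ {1,...,n}^n is the vector with u_i = argmax_j P̂_{sort(s)}(τ)[i,j], then u is a permutation of {1,...,n} and u = sort(s); in particular P̂_{sort(s)}(τ) is a unimodal row-stochastic matrix. -/

import Mathlib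

open Finset

/-- The relaxed sort matrix: its `i`-th row is
`softmax(((n + 1 − 2(i+1))·s − A_s·𝟙)/τ)` (0-based row index `i`), where
`A_s[j,l] = |s_j − s_l|`. -/
noncomputable def relaxedSort (n : ℕ) (s : Fin n → ℝ) (τ : ℝ) (i j : Fin n) : ℝ :=
  Real.exp ((((n : ℝ) + 1 - 2 * (((i : ℕ) : ℝ) + 1)) * s j - ∑ l : Fin n, |s j - s l|) / τ) /
    ∑ j' : Fin n,
      Real.exp ((((n : ℝ) + 1 - 2 * (((i : ℕ) : ℝ) + 1)) * s j' - ∑ l : Fin n, |s j' - s l|) / τ)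

/-- The number of indices of `Fin n` above `i` minus the number below it is `n - 1 - 2 i`. -/
lemma sum_sign_sub_index (n : ℕ) (i : Fin n) :
    ∑ l : Fin n, (1 - (if l < i then (1 : ℝ) else 0) - (if l ≤ i then (1 : ℝ) else 0)) =
      (n : ℝ) + 1 - 2 * (((i : ℕ) : ℝ) + 1) := by
  have h₁ : (univ.filter (fun l : Fin n => l < i)).card = (i : ℕ) := by
    rw [Finset.filter_gt_eq_Iio, Fin.card_Iio]
  have h₂ : (univ.filter (fun l : Fin n => l ≤ i)).card = (i : ℕ) + 1 := by
    rw [Finset.filter_ge_eq_Iic, Fin.card_Iic]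
  simp only [Finset.sum_sub_distrib, Finset.sum_boole, h₁, h₂]
  simp
  ring

/-- If `t` is strictly decreasing, the concave function
`x ↦ (n - 1 - 2 i) x - ∑ l, |x - t l|` is uniquely maximized at `t i`. -/
lemma StrictAnti.score_lt_score {n : ℕ} {t : Fin n → ℝ} (ht : StrictAnti t) (i : Fin n)
    {x : ℝ} (hx : x ≠ t i) :
    ((n : ℝ) + 1 - 2 * (((i : ℕ) : ℝ) + 1)) * x - ∑ l : Fin n, |x - t l| <
      ((n : ℝ) + 1 - 2 * (((i : ℕ) : ℝ) + 1)) * t i - ∑ l : Fin n, |t i - t l| := by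
  rw [← sum_sign_sub_index n i, Finset.sum_mul, Finset.sum_mul, ← Finset.sum_sub_distrib,
    ← Finset.sum_sub_distrib]
  refine Finset.sum_lt_sum (fun l _ => ?_) ⟨i, mem_univ i, ?_⟩
  · rcases lt_trichotomy l i with h | rfl | h
    · rw [abs_of_neg (sub_neg.2 (ht h))]
      simp only [h, h.le, if_true]
      linarith [neg_le_abs (x - t l), le_abs_self (x - t l)]
    · simp
    · rw [abs_of_pos (sub_pos.2 (ht h))]
      simp only [h.not_gt, h.not_ge, if_false]
      linarith [neg_le_abs (x - t l), le_abs_self (x - t l)]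
  · simpa using sub_ne_zero.2 hx

/-- For `τ > 0`, the relaxed sort matrix is row stochastic: all entries are strictly
positive and every row sums to 1. Moreover, if the entries of `s` are pairwise distinct
and `σ = sort(s)` is the descending-sort permutation (i.e. `s ∘ σ` is antitone), then
the argmax of each row `i` is uniquely attained at column `σ i`; in particular the
row-wise argmax vector is the permutation `sort(s)`, so the matrix is unimodal
row-stochastic. -/
theorem relaxedSort_unimodal_row_stochastic (n : ℕ) (s : Fin n → ℝ) (τ : ℝ) (hτ : 0 < τ) :
    (∀ i j : Fin n, 0 < relaxedSort n s τ i j)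
      ∧ (∀ i : Fin n, ∑ j : Fin n, relaxedSort n s τ i j = 1)
      ∧ (∀ σ : Equiv.Perm (Fin n), Function.Injective s →
          Antitone (fun i => s (σ i)) →
          ∀ i j : Fin n, j ≠ σ i → relaxedSort n s τ i j < relaxedSort n s τ i (σ i)) := by
  have hpos (i : Fin n) (j : Fin n) : 0 < ∑ j' : Fin n,
      Real.exp ((((n : ℝ) + 1 - 2 * (((i : ℕ) : ℝ) + 1)) * s j' -
        ∑ l : Fin n, |s j' - s l|) / τ) :=
    Finset.sum_pos (fun _ _ => Real.exp_pos _) ⟨j, mem_univ j⟩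
  refine ⟨fun i j => div_pos (Real.exp_pos _) (hpos i j), fun i => ?_,
    fun σ hs hσ i j hj => ?_⟩
  · simp only [relaxedSort]
    rw [← Finset.sum_div, div_self (hpos i i).ne']
  · have ht : StrictAnti (fun i => s (σ i)) :=
      hσ.strictAnti_of_injective (hs.comp σ.injective)
    have key := ht.score_lt_score i (hs.ne hj)
    simp only [Equiv.sum_comp σ (fun l => |s j - s l|),
      Equiv.sum_comp σ (fun l => |s (σ i) - s l|)] at key
    exact div_lt_div_of_pos_right
      (Real.exp_lt_exp.2 (div_lt_div_of_pos_right key hτ)) (hpos i i)
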